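/- arXiv:2307.04885 — 2 statements merged into one kernel-verified Lean document; each statement's English description precedes it below -/
import Mathlib

section
/- Let n ≥ 1, let P_k and P_{k−1} be symmetric positive definite real n×n matrices, and let A be an invertible real n×n matrix. Then the set of pairs (Q, Ω) of symmetric matrices with Q positive definite, Ω positive semidefinite, and P_k⁻¹ = (A P_{k−1} Aᵀ + Q)⁻¹ + Ω is infinite. -/
open Matrix

theorem Matrix.PosDef.posSemidef_inv_sub_inv_add {n : Type*} [Fintype n] [DecidableEq n]
    {P R : Matrix n n ℝ} (hP : P.PosDef) (hR : R.PosSemidef) :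
    (P⁻¹ - (P + R)⁻¹).PosSemidef := by
  have hS : (P + R).PosDef := hP.add_posSemidef hR
  have hPdet : IsUnit P.det := (isUnit_iff_isUnit_det P).mp hP.isUnit
  have hSdet : IsUnit (P + R).det := (isUnit_iff_isUnit_det _).mp hS.isUnit
  have hcore : (R + R * P⁻¹ * R).PosSemidef := by
    have h := hP.inv.posSemidef.mul_mul_conjTranspose_same R
    rw [hR.isHermitian.eq] at h
    exact hR.add h
  have hexp : R + R * P⁻¹ * R = (P + R) * P⁻¹ * (P + R) - (P + R) := by
    simp only [add_mul, mul_add, mul_nonsing_inv P hPdet, one_mul, mul_assoc,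
      nonsing_inv_mul P hPdet, mul_one]
    abel
  have h := hcore.mul_mul_conjTranspose_same (P + R)⁻¹
  rw [hS.inv.isHermitian.eq, hexp] at h
  convert h using 1
  rw [mul_sub, sub_mul, nonsing_inv_mul _ hSdet, one_mul, mul_assoc, mul_assoc,
    mul_nonsing_inv _ hSdet, mul_one, nonsing_inv_mul_cancel_left _ _ hSdet]

theorem covariance_constraint_solution_set_infinite {n : ℕ} (hn : 1 ≤ n)
    (Pk Pkm1 : Matrix (Fin n) (Fin n) ℝ) (A : Matrix (Fin n) (Fin n) ℝ)
    (hPk : Pk.PosDef) (hPkm1 : Pkm1.PosDef) (hA : IsUnit A) :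
    {p : Matrix (Fin n) (Fin n) ℝ × Matrix (Fin n) (Fin n) ℝ |
      p.1.PosDef ∧ p.2.PosSemidef ∧ Pk⁻¹ = (A * Pkm1 * Aᵀ + p.1)⁻¹ + p.2}.Infinite := by
  have hM : (A * Pkm1 * Aᵀ).PosSemidef := by
    simpa using hPkm1.posSemidef.mul_mul_conjTranspose_same A
  refine Set.infinite_of_injective_forall_mem (f := fun t : ℕ =>
    (Pk + (t : ℝ) • Pk, Pk⁻¹ - (A * Pkm1 * Aᵀ + (Pk + (t : ℝ) • Pk))⁻¹)) ?_ ?_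
  · intro s t hst
    have hentry := congrFun₂ (Prod.ext_iff.mp hst).1 ⟨0, hn⟩ ⟨0, hn⟩
    simpa [(hPk.diag_pos (i := ⟨0, hn⟩)).ne'] using hentry
  · intro t
    have htP : ((t : ℝ) • Pk).PosSemidef := hPk.posSemidef.smul t.cast_nonneg
    refine ⟨hPk.add_posSemidef htP, ?_, (add_sub_cancel _ _).symm⟩
    simpa only [add_left_comm] using hPk.posSemidef_inv_sub_inv_add (hM.add htP)
end

section
/- Let A and L be invertible real n×n matrices, and let P_{k−1} and P_k be symmetric positive definite real n×n matrices. Then for every symmetric real n×n matrix X, the following are equivalent: (i) X is positive definite, P_k⁻¹ − X is positive semidefinite, and (A P_{k−1} Aᵀ)⁻¹ − X is positive definite; (ii) there exists a symmetric positive definite matrix Q such that X = (A P_{k−1} Aᵀ + L Q Lᵀ)⁻¹ and P_k⁻¹ − X is positive semidefinite. -/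
open Matrix

theorem Matrix.PosDef.inv_sub_inv {ι : Type*} [Fintype ι] [DecidableEq ι]
    {S T : Matrix ι ι ℝ} (hS : S.PosDef) (hT : T.PosDef) (h : (S - T).PosDef) :
    (T⁻¹ - S⁻¹).PosDef := by
  have uS : IsUnit S.det := (isUnit_iff_isUnit_det S).mp hS.isUnit
  have uT : IsUnit T.det := (isUnit_iff_isUnit_det T).mp hT.isUnit
  have key : S * (T⁻¹ - S⁻¹) * star S = (S - T) + (S - T) * T⁻¹ * (S - T)ᴴ := by
    rw [h.isHermitian.eq, star_eq_conjTranspose, hS.isHermitian.eq]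
    simp only [mul_sub, sub_mul, mul_nonsing_inv S uS, mul_nonsing_inv T uT,
      nonsing_inv_mul_cancel_right T _ uT, one_mul]
    abel
  rw [← IsUnit.posDef_star_right_conjugate_iff hS.isUnit, key]
  exact h.add_posSemidef (hT.inv.posSemidef.mul_mul_conjTranspose_same _)

theorem Matrix.PosDef.mul_mul_transpose_of_isUnit {ι : Type*} [Fintype ι] [DecidableEq ι]
    {U P : Matrix ι ι ℝ} (hP : P.PosDef) (hU : IsUnit U) : (U * P * Uᵀ).PosDef := by
  simpa [star_eq_conjTranspose] using (IsUnit.posDef_star_right_conjugate_iff hU).mpr hP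

theorem sdp_substitution_equivalence {n : ℕ}
    (A L : Matrix (Fin n) (Fin n) ℝ) (hA : IsUnit A) (hL : IsUnit L)
    (Pkm1 Pk : Matrix (Fin n) (Fin n) ℝ)
    (hPkm1 : Pkm1.PosDef) (hPk : Pk.PosDef) :
    ∀ X : Matrix (Fin n) (Fin n) ℝ, X.IsHermitian →
      (X.PosDef ∧ (Pk⁻¹ - X).PosSemidef ∧ ((A * Pkm1 * Aᵀ)⁻¹ - X).PosDef ↔
        ∃ Q : Matrix (Fin n) (Fin n) ℝ, Q.PosDef ∧
          X = (A * Pkm1 * Aᵀ + L * Q * Lᵀ)⁻¹ ∧ (Pk⁻¹ - X).PosSemidef) := by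
  intro X _
  have hM : (A * Pkm1 * Aᵀ).PosDef := hPkm1.mul_mul_transpose_of_isUnit hA
  generalize A * Pkm1 * Aᵀ = M at hM ⊢
  have uM : IsUnit M.det := (isUnit_iff_isUnit_det M).mp hM.isUnit
  have uL : IsUnit L.det := (isUnit_iff_isUnit_det L).mp hL
  constructor
  · rintro ⟨hX, hPX, hMX⟩
    have uX : IsUnit X.det := (isUnit_iff_isUnit_det X).mp hX.isUnit
    have hD : (X⁻¹ - M).PosDef := by
      simpa only [nonsing_inv_nonsing_inv M uM] using hM.inv.inv_sub_inv hX hMX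
    refine ⟨L⁻¹ * (X⁻¹ - M) * L⁻¹ᵀ,
      hD.mul_mul_transpose_of_isUnit ((isUnit_nonsing_inv_iff).mpr hL), ?_, hPX⟩
    have hLQ : L * (L⁻¹ * (X⁻¹ - M) * L⁻¹ᵀ) * Lᵀ = X⁻¹ - M := by
      rw [mul_assoc L⁻¹, mul_nonsing_inv_cancel_left L _ uL, mul_assoc, ← transpose_mul,
        mul_nonsing_inv L uL, transpose_one, mul_one]
    rw [hLQ, add_sub_cancel, nonsing_inv_nonsing_inv X uX]
  · rintro ⟨Q, hQ, rfl, hPX⟩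
    have hLQ : (L * Q * Lᵀ).PosDef := hQ.mul_mul_transpose_of_isUnit hL
    exact ⟨(hM.add hLQ).inv, hPX, (hM.add hLQ).inv_sub_inv hM (by rwa [add_sub_cancel_left])⟩
end
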